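/- Let the Euclidean plane ℝ² be coloured in red and blue so that there is no red ℓ₂ and no blue ℓ₅. Then there are no seven red points forming a congruent copy of the configuration 𝔗₇, i.e. there is no isometry f of ℝ² such that all seven points of f(𝔗₇) are red. -/

import Mathlib

/-- The two colours. -/
inductive Color
  | red
  | blue

/-- The Euclidean plane ℝ². -/
abbrev Plane : Type := EuclideanSpace ℝ (Fin 2)

/-- The point of the plane with coordinates `(x, y)`. -/
noncomputable def pt (x y : ℝ) : Plane := (WithLp.equiv 2 (Fin 2 → ℝ)).symm ![x, y]

/-- There is no red ℓ₂, i.e. no two red points at Euclidean distance 1. -/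
def NoRedL2 (c : Plane → Color) : Prop :=
  ∀ x y : Plane, c x = Color.red → c y = Color.red → dist x y ≠ 1

/-- There is a blue ℓ₅: a point `p` and a unit vector `w` such that
`p, p+w, p+2w, p+3w, p+4w` are all blue. -/
def HasBlueL5 (c : Plane → Color) : Prop :=
  ∃ p w : Plane, ‖w‖ = 1 ∧ ∀ i : Fin 5, c (p + (i : ℝ) • w) = Color.blue

/-- The configuration 𝔗₇: four collinear points at consecutive distances √3
together with three points of the adjacent parallel row of the triangular
lattice of mesh √3. -/
noncomputable def T7 : Set Plane :=
  {pt 0 0, pt (Real.sqrt 3) 0, pt (2 * Real.sqrt 3) 0, pt (3 * Real.sqrt 3) 0,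
    pt (Real.sqrt 3 / 2) (-(3 / 2)), pt (Real.sqrt 3 / 2 + Real.sqrt 3) (-(3 / 2)),
    pt (Real.sqrt 3 / 2 + 2 * Real.sqrt 3) (-(3 / 2))}

lemma dist_pt_eq_one {x y x' y' : ℝ} (h : (x - x') ^ 2 + (y - y') ^ 2 = 1) :
    dist (pt x y) (pt x' y') = 1 := by
  simp [pt, EuclideanSpace.dist_eq, Fin.sum_univ_two, Real.dist_eq, sq_abs, h]

lemma norm_pt_eq_one {x y : ℝ} (h : x ^ 2 + y ^ 2 = 1) : ‖pt x y‖ = 1 := by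
  simp [pt, EuclideanSpace.norm_eq, Fin.sum_univ_two, sq_abs, h]

lemma pt_add_smul (x y a b r : ℝ) : pt x y + r • pt a b = pt (x + r * a) (y + r * b) := by
  ext i
  fin_cases i <;> simp [pt]

lemma Color.eq_blue_of_ne_red {k : Color} (h : k ≠ Color.red) : k = Color.blue := by
  cases k <;> simp_all

lemma NoRedL2.eq_blue {c : Plane → Color} (h : NoRedL2 c) {x y : Plane}
    (hx : c x = Color.red) (hxy : dist x y = 1) : c y = Color.blue :=
  Color.eq_blue_of_ne_red fun hy => h x y hx hy hxy

lemma NoRedL2.comp_isometryEquiv {c : Plane → Color} (h : NoRedL2 c) (f : Plane ≃ᵢ Plane) :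
    NoRedL2 (c ∘ f) := fun x y hx hy hxy =>
  h (f x) (f y) hx hy (by rw [f.dist_eq, hxy])

lemma HasBlueL5.of_comp_isometryEquiv {c : Plane → Color} (f : Plane ≃ᵢ Plane)
    (h : HasBlueL5 (c ∘ f)) : HasBlueL5 c := by
  obtain ⟨p, w, hw, hb⟩ := h
  refine ⟨f p, f.toRealAffineIsometryEquiv.linearIsometryEquiv w, by simpa using hw, fun i => ?_⟩
  have key := f.toRealAffineIsometryEquiv.map_vadd p ((i : ℝ) • w)
  simp only [vadd_eq_add, map_smul, IsometryEquiv.coeFn_toRealAffineIsometryEquiv] at key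
  rw [add_comm, ← key, add_comm]
  exact hb i

/-- The rhombus of side `√3` contained in `T7` cannot be red: its four vertices
force four blue points on each of two parallel `ℓ₅` whose fifth points are at distance `1`. -/
lemma hasBlueL5_of_red_rhombus {c : Plane → Color} (hc : NoRedL2 c)
    (hA : c (pt (Real.sqrt 3 / 2 + Real.sqrt 3) (-(3 / 2))) = Color.red)
    (hB : c (pt (2 * Real.sqrt 3) 0) = Color.red)
    (hC : c (pt (Real.sqrt 3 / 2 + 2 * Real.sqrt 3) (-(3 / 2))) = Color.red)
    (hD : c (pt (3 * Real.sqrt 3) 0) = Color.red) : HasBlueL5 c := by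
  obtain ⟨s, hs⟩ : ∃ s, s = Real.sqrt 3 := ⟨_, rfl⟩
  obtain ⟨t, ht⟩ : ∃ t, t = Real.sqrt 11 := ⟨_, rfl⟩
  have h3 : s ^ 2 = 3 := by rw [hs]; exact Real.sq_sqrt (by norm_num)
  have h11 : t ^ 2 = 11 := by rw [ht]; exact Real.sq_sqrt (by norm_num)
  have h33 : s ^ 2 * t ^ 2 = 33 := by rw [h3, h11]; norm_num
  rw [← hs] at hA hB hC hD
  have hw : ‖pt (5 * s / 12 + t / 12) (5 / 12 - s * t / 12)‖ = 1 :=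
    norm_pt_eq_one (by ring_nf; linarith)
  by_cases hP : c (pt (5 * s / 3 + 4 * (5 * s / 12 + t / 12))
      (-(3 / 2) + s * t / 6 + 4 * (5 / 12 - s * t / 12))) = Color.red
  · refine ⟨pt (19 * s / 12 - t / 4) (-(5 / 4) + s * t / 12), _, hw, fun i => ?_⟩
    rw [pt_add_smul]
    fin_cases i
    · exact hc.eq_blue hA (dist_pt_eq_one (by norm_num; ring_nf; linarith))
    · exact hc.eq_blue hB (dist_pt_eq_one (by norm_num; ring_nf; linarith))
    · exact hc.eq_blue hB (dist_pt_eq_one (by norm_num; ring_nf; linarith))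
    · exact hc.eq_blue hD (dist_pt_eq_one (by norm_num; ring_nf; linarith))
    · exact hc.eq_blue hP (dist_pt_eq_one (by norm_num; ring_nf; linarith))
  · refine ⟨pt (5 * s / 3) (-(3 / 2) + s * t / 6), _, hw, fun i => ?_⟩
    rw [pt_add_smul]
    fin_cases i
    · exact hc.eq_blue hA (dist_pt_eq_one (by norm_num; ring_nf; linarith))
    · exact hc.eq_blue hC (dist_pt_eq_one (by norm_num; ring_nf; linarith))
    · exact hc.eq_blue hC (dist_pt_eq_one (by norm_num; ring_nf; linarith))
    · exact hc.eq_blue hD (dist_pt_eq_one (by norm_num; ring_nf; linarith))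
    · simpa using Color.eq_blue_of_ne_red hP

/-- no red ℓ₂ and no blue ℓ₅ imply there is no congruent copy of
𝔗₇ all of whose points are red. -/
theorem stmt_3 (c : Plane → Color) (hred : NoRedL2 c) (hblue : ¬ HasBlueL5 c) :
    ¬ ∃ f : Plane ≃ᵢ Plane, ∀ q ∈ T7, c (f q) = Color.red := by
  rintro ⟨f, hf⟩
  exact hblue (HasBlueL5.of_comp_isometryEquiv f (hasBlueL5_of_red_rhombus
    (hred.comp_isometryEquiv f) (hf _ (by simp [T7])) (hf _ (by simp [T7]))
    (hf _ (by simp [T7])) (hf _ (by simp [T7]))))
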